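/- Let S be a local commutative semiring with 1 ≠ 0 and M a unital S-semimodule. If N is a weakly 1-absorbing prime subtractive subsemimodule of M that is not 1-absorbing prime, then (N :_S M)² • N = 0, i.e., (s*t) • n = 0 for all s, t ∈ (N :_S M) and all n ∈ N. -/

import Mathlib

open Submodule

/-- The ideal `(N :_S M) = {s : S | s • M ⊆ N}`. -/
def colonSM {S M : Type*} [CommSemiring S] [AddCommMonoid M] [Module S M]
    (N : Submodule S M) : Ideal S where
  carrier := {s : S | ∀ m : M, s • m ∈ N}
  add_mem' := by
    intro a b ha hb m
    rw [add_smul]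
    exact N.add_mem (ha m) (hb m)
  zero_mem' := by
    intro m
    rw [zero_smul]
    exact N.zero_mem
  smul_mem' := by
    intro c s hs m
    rw [smul_eq_mul, mul_smul]
    exact N.smul_mem c (hs m)

/-- A prime subsemimodule: a proper subsemimodule `N` such that `a • m ∈ N` implies
`a ∈ (N :_S M)` or `m ∈ N`. -/
def IsPrimeSubmodule {S M : Type*} [CommSemiring S] [AddCommMonoid M] [Module S M]
    (N : Submodule S M) : Prop :=
  N ≠ ⊤ ∧ ∀ (a : S) (m : M), a • m ∈ N → a ∈ colonSM N ∨ m ∈ N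

/-- A `1`-absorbing prime subsemimodule: a proper subsemimodule `N` such that for all
nonunits `a b : S` and `m : M`, `(a * b) • m ∈ N` implies `a * b ∈ (N :_S M)` or `m ∈ N`. -/
def IsOneAbsorbingPrimeSubmodule {S M : Type*} [CommSemiring S] [AddCommMonoid M] [Module S M]
    (N : Submodule S M) : Prop :=
  N ≠ ⊤ ∧ ∀ a b : S, ¬ IsUnit a → ¬ IsUnit b → ∀ m : M,
    (a * b) • m ∈ N → a * b ∈ colonSM N ∨ m ∈ N

/-- A weakly `1`-absorbing prime subsemimodule: a proper subsemimodule `N` such that for all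
nonunits `a b : S` and `m : M`, `0 ≠ (a * b) • m ∈ N` implies `a * b ∈ (N :_S M)` or `m ∈ N`. -/
def IsWeaklyOneAbsorbingPrimeSubmodule {S M : Type*} [CommSemiring S] [AddCommMonoid M]
    [Module S M] (N : Submodule S M) : Prop :=
  N ≠ ⊤ ∧ ∀ a b : S, ¬ IsUnit a → ¬ IsUnit b → ∀ m : M,
    (a * b) • m ∈ N → (a * b) • m ≠ 0 → a * b ∈ colonSM N ∨ m ∈ N

/-- A `1`-absorbing prime ideal: a proper ideal `I` such that for all nonunits `a b c : S`,
`a * b * c ∈ I` implies `a * b ∈ I` or `c ∈ I`. -/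
def IsOneAbsorbingPrimeIdeal {S : Type*} [CommSemiring S] (I : Ideal S) : Prop :=
  I ≠ ⊤ ∧ ∀ a b c : S, ¬ IsUnit a → ¬ IsUnit b → ¬ IsUnit c →
    a * b * c ∈ I → a * b ∈ I ∨ c ∈ I

/-- A weakly `1`-absorbing prime ideal: a proper ideal `I` such that for all nonunits
`a b c : S`, `0 ≠ a * b * c ∈ I` implies `a * b ∈ I` or `c ∈ I`. -/
def IsWeaklyOneAbsorbingPrimeIdeal {S : Type*} [CommSemiring S] (I : Ideal S) : Prop :=
  I ≠ ⊤ ∧ ∀ a b c : S, ¬ IsUnit a → ¬ IsUnit b → ¬ IsUnit c →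
    a * b * c ∈ I → a * b * c ≠ 0 → a * b ∈ I ∨ c ∈ I

/-- A local semiring: the sum of any two nonunits is a nonunit. -/
def IsLocalSemiring (S : Type*) [CommSemiring S] : Prop :=
  ∀ a b : S, ¬ IsUnit a → ¬ IsUnit b → ¬ IsUnit (a + b)

/-- A subtractive subsemimodule: `x ∈ N` and `x + y ∈ N` imply `y ∈ N`. -/
def Subtractive {S M : Type*} [CommSemiring S] [AddCommMonoid M] [Module S M]
    (N : Submodule S M) : Prop :=
  ∀ x y : M, x ∈ N → x + y ∈ N → y ∈ N

/-- A strong subsemimodule: every element of `N` has an additive inverse in `N`. -/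
def StrongSubmodule {S M : Type*} [CommSemiring S] [AddCommMonoid M] [Module S M]
    (N : Submodule S M) : Prop :=
  ∀ x ∈ N, ∃ y ∈ N, x + y = 0

/-- A multiplication semimodule: every subsemimodule has the form `I • M` for an ideal `I`. -/
def IsMultiplicationSemimodule (S M : Type*) [CommSemiring S] [AddCommMonoid M]
    [Module S M] : Prop :=
  ∀ N : Submodule S M, ∃ I : Ideal S, N = I • (⊤ : Submodule S M)

/-- A multiplicatively cancellative (MC) semimodule: `s • x = t • x` with `x ≠ 0`
implies `s = t`. -/
def IsMC (S M : Type*) [CommSemiring S] [AddCommMonoid M] [Module S M] : Prop :=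
  ∀ (s t : S) (x : M), x ≠ 0 → s • x = t • x → s = t

theorem mem_colonSM {S M : Type*} [CommSemiring S] [AddCommMonoid M] [Module S M]
    {N : Submodule S M} {s : S} : s ∈ colonSM N ↔ ∀ m : M, s • m ∈ N :=
  Iff.rfl

theorem not_isUnit_of_mem_colonSM {S M : Type*} [CommSemiring S] [AddCommMonoid M] [Module S M]
    {N : Submodule S M} (hN : N ≠ ⊤) {s : S} (hs : s ∈ colonSM N) : ¬ IsUnit s := by
  rintro ⟨u, rfl⟩
  refine hN (eq_top_iff.2 fun m _ => ?_)
  simpa [smul_smul] using mem_colonSM.1 hs ((↑u⁻¹ : S) • m)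

/-- A witness `(a, b, m)` that `N` is not `1`-absorbing prime stays annihilating under
perturbation of `a` and `b` by `(N :_S M)` and of `m` by `N`. -/
theorem IsWeaklyOneAbsorbingPrimeSubmodule.add_mul_add_smul_add_eq_zero
    {S M : Type*} [CommSemiring S] [AddCommMonoid M] [Module S M]
    (hloc : IsLocalSemiring S) {N : Submodule S M}
    (hw : IsWeaklyOneAbsorbingPrimeSubmodule N) (hsub : Subtractive N)
    {a b : S} (ha : ¬ IsUnit a) (hb : ¬ IsUnit b) {m : M} (habm : (a * b) • m ∈ N)
    (hab : a * b ∉ colonSM N) (hm : m ∉ N)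
    {s t : S} (hs : s ∈ colonSM N) (ht : t ∈ colonSM N) {n : M} (hn : n ∈ N) :
    ((a + s) * (b + t)) • (m + n) = 0 := by
  have hI : a * t + s * b + s * t ∈ colonSM N :=
    add_mem (add_mem (Ideal.mul_mem_left _ a ht) (Ideal.mul_mem_right b _ hs))
      (Ideal.mul_mem_left _ s ht)
  have hprod : (a + s) * (b + t) = (a * t + s * b + s * t) + a * b := by ring
  by_contra hne
  have hmem : ((a + s) * (b + t)) • (m + n) ∈ N := by
    rw [hprod, add_smul, smul_add (a * b)]
    exact N.add_mem (hI _) (N.add_mem habm (N.smul_mem _ hn))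
  rcases hw.2 _ _ (hloc _ _ ha (not_isUnit_of_mem_colonSM hw.1 hs))
    (hloc _ _ hb (not_isUnit_of_mem_colonSM hw.1 ht)) _ hmem hne with h | h
  · refine hab fun x => hsub _ _ (hI x) ?_
    rw [← add_smul, ← hprod]
    exact h x
  · exact hm (hsub n m hn (by rwa [add_comm]))

/-- Let `S` be a local semiring. If `N` is a weakly `1`-absorbing prime subtractive
subsemimodule of `M` that is not `1`-absorbing prime, then `(N :_S M)² • N = 0`. -/
theorem colonSM_sq_smul_eq_zero_of_not_oneAbsorbingPrime
    {S M : Type*} [CommSemiring S] [Nontrivial S] [AddCommMonoid M] [Module S M]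
    (hloc : IsLocalSemiring S) (N : Submodule S M)
    (hw : IsWeaklyOneAbsorbingPrimeSubmodule N) (hsub : Subtractive N)
    (hnot : ¬ IsOneAbsorbingPrimeSubmodule N) :
    ∀ s ∈ colonSM N, ∀ t ∈ colonSM N, ∀ n ∈ N, (s * t) • n = 0 := by
  intro s hs t ht n hn
  have hwit : ∃ a b : S, ¬ IsUnit a ∧ ¬ IsUnit b ∧ ∃ m : M,
      (a * b) • m ∈ N ∧ a * b ∉ colonSM N ∧ m ∉ N := by
    by_contra! h
    exact hnot ⟨hw.1, fun a b ha hb m hm => or_iff_not_imp_left.2 (h a b ha hb m hm)⟩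
  obtain ⟨a, b, ha, hb, m, habm, hab, hm⟩ := hwit
  have key {s t : S} (hs : s ∈ colonSM N) (ht : t ∈ colonSM N) {n : M} (hn : n ∈ N) :
      ((a + s) * (b + t)) • (m + n) = 0 :=
    hw.add_mul_add_smul_add_eq_zero hloc hsub ha hb habm hab hm hs ht hn
  have h0 := (colonSM N).zero_mem
  have h₁ := key h0 h0 N.zero_mem
  have h₂ := key h0 h0 hn
  have h₃ := key hs h0 N.zero_mem
  have h₄ := key h0 ht N.zero_mem
  have h₅ := key hs ht N.zero_mem
  have h₆ := key hs h0 hn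
  have h₇ := key h0 ht hn
  have h₈ := key hs ht hn
  simp only [add_zero, add_mul, mul_add, add_smul, smul_add] at h₁ h₂ h₃ h₄ h₅ h₆ h₇ h₈
  simp_all
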